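/- Theorem 2 (loss bound for the two-level VAW² algorithm, relation (3.14)): under the setup below, for every j ∈ {1,…,N} and every coefficient function γ_j, (1/2) E_θ[Σ_{t=1}^T (⟨α_t, z_t⟩ − y_t)²] ≤ (1/2) Σ_{t=1}^T (f_j(x_t) − y_t)² + λ/2 + (λ/2 + T)·I_j/m + (m Y²/2)·ln(1 + 2T/λ) + (N Y²/2)·ln(1 + (Y²/λ)·(2T(T+1) + 2 m T ln(1 + 2T/λ))). -/

import Mathlib

open MeasureTheory

/-- The Vovk–Azoury–Warmuth (VAW) iterates with regularization parameter `lam`,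
applied to input vectors `u 1, u 2, …` (indexed by a finite type `ι`) and labels
`y 1, y 2, …`:  `w t = S t ⁻¹ (∑_{i=1}^{t-1} y i • u i)`, where
`S t = lam • I + ∑_{i=1}^{t} (u i) (u i)ᵀ`. -/
noncomputable def vaw {ι : Type*} [Fintype ι] [DecidableEq ι] (lam : ℝ)
    (u : ℕ → ι → ℝ) (y : ℕ → ℝ) (t : ℕ) : ι → ℝ :=
  ((lam • (1 : Matrix ι ι ℝ) + ∑ i ∈ Finset.Icc 1 t, Matrix.vecMulVec (u i) (u i))⁻¹).mulVec
    (∑ i ∈ Finset.Icc 1 (t - 1), y i • u i)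

section LinearAlgebra

open Matrix

variable {ι : Type*} [Fintype ι]

/-- A real symmetric matrix defines a symmetric bilinear form. -/
lemma dotProduct_mulVec_comm_of_isHermitian {A : Matrix ι ι ℝ} (hA : A.IsHermitian)
    (x y : ι → ℝ) : x ⬝ᵥ A *ᵥ y = y ⬝ᵥ A *ᵥ x := by
  have hT : Aᵀ = A := by simpa using hA.eq
  rw [dotProduct_mulVec, ← mulVec_transpose, hT, dotProduct_comm]

lemma posSemidef_vecMulVec_self (u : ι → ℝ) : (vecMulVec u u).PosSemidef := by
  simpa using posSemidef_vecMulVec_self_star u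

variable [DecidableEq ι]

/-- The inverse quadratic form of a positive definite matrix is nonnegative. -/
lemma inv_quadForm_nonneg {S : Matrix ι ι ℝ} (hS : S.PosDef) (x : ι → ℝ) :
    0 ≤ x ⬝ᵥ S⁻¹ *ᵥ x := by
  simpa using hS.inv.posSemidef.dotProduct_mulVec_nonneg x

/-- The effect of a rank-one update of a matrix on its inverse (Sherman–Morrison). -/
lemma inv_mulVec_eq_of_rank_one_update {S : Matrix ι ι ℝ} (hS : S.PosDef) (u b : ι → ℝ) :
    S⁻¹ *ᵥ b = (S + vecMulVec u u)⁻¹ *ᵥ b +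
      (u ⬝ᵥ S⁻¹ *ᵥ b) • (S + vecMulVec u u)⁻¹ *ᵥ u := by
  have hS' : (S + vecMulVec u u).PosDef := hS.add_posSemidef (posSemidef_vecMulVec_self u)
  have hdet : IsUnit S.det := S.isUnit_iff_isUnit_det.mp hS.isUnit
  have hdet' : IsUnit (S + vecMulVec u u).det := (isUnit_iff_isUnit_det _).mp hS'.isUnit
  have key : (S + vecMulVec u u) *ᵥ (S⁻¹ *ᵥ b) = b + (u ⬝ᵥ S⁻¹ *ᵥ b) • u := by
    rw [add_mulVec, mulVec_mulVec, mul_nonsing_inv _ hdet, one_mulVec, vecMulVec_mulVec]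
    simp
  have := congrArg (fun w => (S + vecMulVec u u)⁻¹ *ᵥ w) key
  beta_reduce at this
  rwa [mulVec_mulVec, nonsing_inv_mul _ hdet', one_mulVec, mulVec_add, mulVec_smul] at this

lemma quadForm_inv_rank_one_update {S : Matrix ι ι ℝ} (hS : S.PosDef) (u : ι → ℝ) :
    u ⬝ᵥ S⁻¹ *ᵥ u = u ⬝ᵥ (S + vecMulVec u u)⁻¹ *ᵥ u +
      (u ⬝ᵥ S⁻¹ *ᵥ u) * (u ⬝ᵥ (S + vecMulVec u u)⁻¹ *ᵥ u) := by
  simpa [dotProduct_add, dotProduct_smul] using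
    congrArg (u ⬝ᵥ ·) (inv_mulVec_eq_of_rank_one_update hS u u)

/-- The squared prediction after a rank-one update is bounded by the decrease of the inverse
quadratic form. -/
lemma sq_dotProduct_inv_mulVec_le {S : Matrix ι ι ℝ} (hS : S.PosDef) (u b : ι → ℝ) :
    (u ⬝ᵥ (S + vecMulVec u u)⁻¹ *ᵥ b) ^ 2 ≤
      b ⬝ᵥ S⁻¹ *ᵥ b - b ⬝ᵥ (S + vecMulVec u u)⁻¹ *ᵥ b := by
  have hS' : (S + vecMulVec u u).PosDef := hS.add_posSemidef (posSemidef_vecMulVec_self u)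
  have hsymm := dotProduct_mulVec_comm_of_isHermitian hS'.inv.isHermitian b u
  have hu := quadForm_inv_rank_one_update hS u
  have h1 := congrArg (u ⬝ᵥ ·) (inv_mulVec_eq_of_rank_one_update hS u b)
  have h2 := congrArg (b ⬝ᵥ ·) (inv_mulVec_eq_of_rank_one_update hS u b)
  have ha := inv_quadForm_nonneg hS' u
  have ha' := inv_quadForm_nonneg hS u
  simp only [dotProduct_add, dotProduct_smul, smul_eq_mul] at h1 h2
  rw [hsymm] at h2
  rw [h2]
  generalize u ⬝ᵥ (S + vecMulVec u u)⁻¹ *ᵥ u = a at *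
  generalize u ⬝ᵥ S⁻¹ *ᵥ u = a' at *
  generalize u ⬝ᵥ S⁻¹ *ᵥ b = q at *
  generalize u ⬝ᵥ (S + vecMulVec u u)⁻¹ *ᵥ b = r at *
  have ha1 : 0 ≤ 1 - a := by
    have : (1 - a) * (1 + a') = 1 := by linarith
    by_contra hneg
    nlinarith
  have hr : r = (1 - a) * q := by linarith
  have := mul_nonneg (mul_nonneg ha ha1) (sq_nonneg q)
  rw [hr]
  nlinarith

lemma det_rank_one_update {S : Matrix ι ι ℝ} (hS : S.PosDef) (u : ι → ℝ) :
    (S + vecMulVec u u).det = S.det * (1 + u ⬝ᵥ S⁻¹ *ᵥ u) := by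
  have hdet : IsUnit S.det := S.isUnit_iff_isUnit_det.mp hS.isUnit
  rw [vecMulVec_eq Unit, det_add_replicateCol_mul_replicateRow hdet]
  congr 1
  rw [det_unique, Matrix.add_apply, one_apply_eq, Matrix.mul_assoc]
  simp [Matrix.mul_apply, dotProduct, mulVec]

lemma quadForm_inv_le_log_det_sub {S : Matrix ι ι ℝ} (hS : S.PosDef) (u : ι → ℝ) :
    u ⬝ᵥ (S + vecMulVec u u)⁻¹ *ᵥ u ≤
      Real.log (S + vecMulVec u u).det - Real.log S.det := by
  have hu := quadForm_inv_rank_one_update hS u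
  have ha' := inv_quadForm_nonneg hS u
  rw [det_rank_one_update hS, Real.log_mul hS.det_pos.ne' (by positivity)]
  have := Real.one_sub_inv_le_log_of_pos (show 0 < 1 + u ⬝ᵥ S⁻¹ *ᵥ u by positivity)
  have heq : u ⬝ᵥ (S + vecMulVec u u)⁻¹ *ᵥ u = 1 - (1 + u ⬝ᵥ S⁻¹ *ᵥ u)⁻¹ := by
    field_simp
    linarith
  linarith

/-- A positive definite matrix of trace at most `n c` has determinant at most `c ^ n`,
in logarithmic form. -/
lemma log_det_le_of_trace_le {S : Matrix ι ι ℝ} (hS : S.PosDef) {c : ℝ} (hc : 0 < c)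
    (htr : S.trace ≤ Fintype.card ι * c) :
    Real.log S.det ≤ Fintype.card ι * Real.log c := by
  have hdet := hS.isHermitian.det_eq_prod_eigenvalues
  have htr' := hS.isHermitian.trace_eq_sum_eigenvalues
  simp only [RCLike.ofReal_real_eq_id, id_eq] at hdet htr'
  rw [hdet, Real.log_prod fun i _ => (hS.eigenvalues_pos i).ne']
  have hle : ∀ i, Real.log (hS.isHermitian.eigenvalues i) ≤
      hS.isHermitian.eigenvalues i / c - 1 + Real.log c := fun i => by
    have h := Real.log_le_sub_one_of_pos (div_pos (hS.eigenvalues_pos i) hc)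
    rw [Real.log_div (hS.eigenvalues_pos i).ne' hc.ne'] at h
    linarith
  refine (Finset.sum_le_sum fun i _ => hle i).trans ?_
  rw [Finset.sum_add_distrib, Finset.sum_sub_distrib, ← Finset.sum_div, ← htr']
  have : S.trace / c ≤ Fintype.card ι := (div_le_iff₀ hc).mpr htr
  simp
  linarith

/-- Completing the square. -/
lemma neg_inv_quadForm_le {S : Matrix ι ι ℝ} (hS : S.PosDef) (b v : ι → ℝ) :
    -(b ⬝ᵥ S⁻¹ *ᵥ b) ≤ v ⬝ᵥ S *ᵥ v - 2 * (v ⬝ᵥ b) := by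
  have hdet : IsUnit S.det := S.isUnit_iff_isUnit_det.mp hS.isUnit
  have h := hS.posSemidef.dotProduct_mulVec_nonneg (v - S⁻¹ *ᵥ b)
  have hs := dotProduct_mulVec_comm_of_isHermitian hS.isHermitian (S⁻¹ *ᵥ b) v
  have hb : S *ᵥ (S⁻¹ *ᵥ b) = b := by rw [mulVec_mulVec, mul_nonsing_inv _ hdet, one_mulVec]
  rw [hb] at hs
  simp only [star_trivial, mulVec_sub, dotProduct_sub, sub_dotProduct, hb, hs] at h
  rw [dotProduct_comm (S⁻¹ *ᵥ b) b] at h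
  linarith

end LinearAlgebra

section Regret

open Matrix

variable {ι : Type*} [DecidableEq ι]

/-- The regularized Gram matrix `lam • I + ∑_{i ≤ t} (u i) (u i)ᵀ`. -/
noncomputable def regGram (lam : ℝ) (u : ℕ → ι → ℝ) (t : ℕ) : Matrix ι ι ℝ :=
  lam • (1 : Matrix ι ι ℝ) + ∑ i ∈ Finset.Icc 1 t, vecMulVec (u i) (u i)

lemma regGram_succ (lam : ℝ) (u : ℕ → ι → ℝ) (t : ℕ) :
    regGram lam u (t + 1) = regGram lam u t + vecMulVec (u (t + 1)) (u (t + 1)) := by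
  rw [regGram, regGram, Finset.sum_Icc_succ_top (by omega), add_assoc]

variable [Fintype ι]

lemma regGram_posDef {lam : ℝ} (hlam : 0 < lam) (u : ℕ → ι → ℝ) (t : ℕ) :
    (regGram lam u t).PosDef :=
  (PosDef.one.smul hlam).add_posSemidef
    (posSemidef_sum _ fun i _ => posSemidef_vecMulVec_self (u i))

lemma trace_regGram (lam : ℝ) (u : ℕ → ι → ℝ) (t : ℕ) :
    (regGram lam u t).trace =
      Fintype.card ι * lam + ∑ i ∈ Finset.Icc 1 t, ∑ k, u i k ^ 2 := by
  simp [regGram, trace_sum, trace_add, dotProduct, sq, mul_comm lam]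

lemma dotProduct_regGram_mulVec (lam : ℝ) (u : ℕ → ι → ℝ) (t : ℕ) (v : ι → ℝ) :
    v ⬝ᵥ regGram lam u t *ᵥ v =
      lam * ∑ k, v k ^ 2 + ∑ i ∈ Finset.Icc 1 t, (v ⬝ᵥ u i) ^ 2 := by
  simp only [regGram, add_mulVec, dotProduct_add, sum_mulVec, dotProduct_sum, smul_mulVec,
    one_mulVec, dotProduct_smul, vecMulVec_mulVec]
  congr 1
  · simp [dotProduct, sq]
  · refine Finset.sum_congr rfl fun i _ => ?_
    simp [dotProduct_comm (u i) v, sq]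

/-- The loss of the VAW iterates in terms of the optimal regularized loss in hindsight. -/
lemma vaw_loss_le_log_det {lam Y : ℝ} (hlam : 0 < lam) (u : ℕ → ι → ℝ) (y : ℕ → ℝ) (T : ℕ)
    (hy : ∀ t ∈ Finset.Icc 1 T, |y t| ≤ Y) :
    ∑ t ∈ Finset.Icc 1 T, ((∑ k, vaw lam u y t k * u t k) - y t) ^ 2 ≤
      ∑ t ∈ Finset.Icc 1 T, y t ^ 2 -
        (∑ i ∈ Finset.Icc 1 T, y i • u i) ⬝ᵥ
          (regGram lam u T)⁻¹ *ᵥ (∑ i ∈ Finset.Icc 1 T, y i • u i) +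
        Y ^ 2 * (Real.log (regGram lam u T).det - Fintype.card ι * Real.log lam) := by
  induction T with
  | zero => simp [regGram]
  | succ T ih =>
    have ih := ih fun t ht => hy t (Finset.Icc_subset_Icc_right (Nat.le_succ T) ht)
    have hyT : |y (T + 1)| ≤ Y := hy _ (by simp)
    have hS := regGram_posDef hlam u T
    rw [Finset.sum_Icc_succ_top (by omega), Finset.sum_Icc_succ_top (by omega),
      Finset.sum_Icc_succ_top (by omega)]
    have hpred : ∑ k, vaw lam u y (T + 1) k * u (T + 1) k =
        u (T + 1) ⬝ᵥ (regGram lam u (T + 1))⁻¹ *ᵥ (∑ i ∈ Finset.Icc 1 T, y i • u i) := by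
      rw [dotProduct_comm]
      rfl
    rw [hpred]
    generalize ∑ i ∈ Finset.Icc 1 T, y i • u i = b at *
    have hS' := regGram_posDef hlam u (T + 1)
    have hsymm := dotProduct_mulVec_comm_of_isHermitian hS'.inv.isHermitian b (u (T + 1))
    have h1 := sq_dotProduct_inv_mulVec_le hS (u (T + 1)) b
    have h2 := quadForm_inv_le_log_det_sub hS (u (T + 1))
    have h3 := inv_quadForm_nonneg hS' (u (T + 1))
    rw [← regGram_succ] at h1 h2
    simp only [mulVec_add, mulVec_smul, dotProduct_add, add_dotProduct, dotProduct_smul,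
      smul_dotProduct, smul_eq_mul, hsymm]
    have h4 : y (T + 1) ^ 2 ≤ Y ^ 2 := sq_le_sq.mpr (hyT.trans (le_abs_self Y))
    have h5 := mul_le_mul_of_nonneg_right h4 h3
    have h6 := mul_le_mul_of_nonneg_left h2 (sq_nonneg Y)
    linarith

/-- Regret bound for the VAW iterates against a fixed comparator `v`. -/
lemma vaw_regret {lam Y : ℝ} (hlam : 0 < lam) (u : ℕ → ι → ℝ) (y : ℕ → ℝ) (T : ℕ)
    (hy : ∀ t ∈ Finset.Icc 1 T, |y t| ≤ Y) {B : ℝ} (hB : 0 ≤ B)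
    (hu : ∑ t ∈ Finset.Icc 1 T, ∑ k, u t k ^ 2 ≤ Fintype.card ι * (lam * B)) (v : ι → ℝ) :
    ∑ t ∈ Finset.Icc 1 T, ((∑ k, vaw lam u y t k * u t k) - y t) ^ 2 ≤
      ∑ t ∈ Finset.Icc 1 T, ((∑ k, v k * u t k) - y t) ^ 2 + lam * ∑ k, v k ^ 2 +
        Fintype.card ι * Y ^ 2 * Real.log (1 + B) := by
  have hS := regGram_posDef hlam u T
  have h1 := vaw_loss_le_log_det hlam u y T hy
  have h2 := neg_inv_quadForm_le hS (∑ i ∈ Finset.Icc 1 T, y i • u i) v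
  have h3 : Real.log (regGram lam u T).det ≤ Fintype.card ι * Real.log (lam * (1 + B)) := by
    refine log_det_le_of_trace_le hS (by positivity) ?_
    rw [trace_regGram]
    linarith
  rw [Real.log_mul hlam.ne' (by positivity)] at h3
  have h4 := mul_le_mul_of_nonneg_left h3 (sq_nonneg Y)
  rw [dotProduct_regGram_mulVec, dotProduct_sum] at h2
  simp only [dotProduct_smul, smul_eq_mul] at h2
  have h5 : ∑ t ∈ Finset.Icc 1 T, ((∑ k, v k * u t k) - y t) ^ 2 =
      ∑ t ∈ Finset.Icc 1 T, (v ⬝ᵥ u t) ^ 2 - 2 * ∑ t ∈ Finset.Icc 1 T, y t * (v ⬝ᵥ u t) +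
        ∑ t ∈ Finset.Icc 1 T, y t ^ 2 := by
    rw [Finset.mul_sum, ← Finset.sum_sub_distrib, ← Finset.sum_add_distrib]
    exact Finset.sum_congr rfl fun t _ => by simp only [dotProduct]; ring
  linarith

/-- The predictions of the VAW iterates are bounded in mean square. -/
lemma vaw_sum_sq_prediction_le {lam Y : ℝ} (hlam : 0 < lam) (u : ℕ → ι → ℝ) (y : ℕ → ℝ)
    (T : ℕ) (hy : ∀ t ∈ Finset.Icc 1 T, |y t| ≤ Y) {B : ℝ} (hB : 0 ≤ B)
    (hu : ∑ t ∈ Finset.Icc 1 T, ∑ k, u t k ^ 2 ≤ Fintype.card ι * (lam * B)) :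
    ∑ t ∈ Finset.Icc 1 T, (∑ k, vaw lam u y t k * u t k) ^ 2 ≤
      Y ^ 2 * (4 * T + 2 * Fintype.card ι * Real.log (1 + B)) := by
  have h1 := vaw_regret hlam u y T hy hB hu 0
  have h2 : ∑ t ∈ Finset.Icc 1 T, y t ^ 2 ≤ T * Y ^ 2 := by
    refine (Finset.sum_le_card_nsmul _ _ (Y ^ 2) fun t ht =>
      sq_le_sq.mpr ((hy t ht).trans (le_abs_self Y))).trans ?_
    simp
  have h3 : ∑ t ∈ Finset.Icc 1 T, (∑ k, vaw lam u y t k * u t k) ^ 2 ≤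
      2 * ∑ t ∈ Finset.Icc 1 T, ((∑ k, vaw lam u y t k * u t k) - y t) ^ 2 +
        2 * ∑ t ∈ Finset.Icc 1 T, y t ^ 2 := by
    rw [Finset.mul_sum, Finset.mul_sum, ← Finset.sum_add_distrib]
    refine Finset.sum_le_sum fun t _ => ?_
    nlinarith [sq_nonneg ((∑ k, vaw lam u y t k * u t k) - 2 * y t)]
  simp at h1
  linarith

end Regret

section RandomFeatures

open ProbabilityTheory

/-- Mean squared error of the empirical mean of `m` independent samples as an estimator
of `c`. -/
lemma integral_sq_empirical_mean_sub_le {Ω : Type*} [MeasurableSpace Ω] {P : Measure Ω}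
    [IsProbabilityMeasure P] {X : Ω → ℝ} (hX : MemLp X 2 P) {m : ℕ} (hm : 0 < m) (c : ℝ) :
    Integrable (fun ω : Fin m → Ω => ((∑ k, X (ω k) / m) - c) ^ 2) (Measure.pi fun _ => P) ∧
      ∫ ω : Fin m → Ω, ((∑ k, X (ω k) / m) - c) ^ 2 ∂(Measure.pi fun _ => P) ≤
        (∫ θ, X θ ∂P - c) ^ 2 + (∫ θ, X θ ^ 2 ∂P) / m := by
  have hm' : (m : ℝ) ≠ 0 := by positivity
  have hXm : MemLp (fun θ => X θ / m) 2 P := by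
    simpa [div_eq_inv_mul] using hX.const_mul (m : ℝ)⁻¹
  have hZ : MemLp (fun ω : Fin m → Ω => ∑ k, X (ω k) / m) 2 (Measure.pi fun _ => P) :=
    memLp_finsetSum _ fun k _ => hXm.comp_measurePreserving (measurePreserving_eval _ k)
  have hZc : MemLp (fun ω : Fin m → Ω => (∑ k, X (ω k) / m) - c) 2 (Measure.pi fun _ => P) :=
    hZ.sub (memLp_const c)
  refine ⟨hZc.integrable_sq, ?_⟩
  have hmean : ∫ ω : Fin m → Ω, (∑ k, X (ω k) / m) ∂(Measure.pi fun _ => P) = ∫ θ, X θ ∂P := by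
    rw [integral_finsetSum _ fun k _ =>
      integrable_comp_eval (μ := fun _ : Fin m => P) (hXm.integrable one_le_two)]
    simp_rw [integral_comp_eval (μ := fun _ : Fin m => P) hXm.aestronglyMeasurable]
    simp only [integral_div, Finset.sum_const, Finset.card_univ, Fintype.card_fin, nsmul_eq_mul]
    field_simp
  have hvar : Var[fun ω : Fin m → Ω => ∑ k, X (ω k) / m; Measure.pi fun _ => P] ≤
      (∫ θ, X θ ^ 2 ∂P) / m := by
    have h := variance_sum_pi (μ := fun _ : Fin m => P) (X := fun _ θ => X θ / m) fun _ => hXm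
    have heq : (∑ k : Fin m, fun ω : Fin m → Ω => X (ω k) / m) =
        fun ω => ∑ k, X (ω k) / m := by
      ext ω
      simp
    rw [heq] at h
    rw [h]
    simp only [div_eq_inv_mul, variance_const_mul, Finset.sum_const, Finset.card_univ,
      Fintype.card_fin, nsmul_eq_mul]
    have h' := variance_le_expectation_sq hX.aestronglyMeasurable
    calc (m : ℝ) * ((m : ℝ)⁻¹ ^ 2 * Var[X; P]) = (m : ℝ)⁻¹ * Var[X; P] := by field_simp
      _ ≤ (m : ℝ)⁻¹ * ∫ θ, X θ ^ 2 ∂P := by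
        exact mul_le_mul_of_nonneg_left h' (by positivity)
  have h := variance_eq_sub hZc
  rw [variance_sub_const hZ.aestronglyMeasurable,
    integral_sub (hZ.integrable one_le_two) (integrable_const c), hmean] at h
  simp only [Pi.pow_apply, integral_const, probReal_univ, one_smul] at h
  linarith

variable {Θ : Type*} [MeasurableSpace Θ] {μ : Measure Θ} {p γ : Θ → ℝ}

lemma integral_withDensity_ofReal (hp : Measurable p) (hp_nonneg : ∀ θ, 0 ≤ p θ) (g : Θ → ℝ) :
    ∫ θ, g θ ∂(μ.withDensity fun θ => ENNReal.ofReal (p θ)) = ∫ θ, p θ * g θ ∂μ := by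
  rw [integral_withDensity_eq_integral_toReal_smul hp.ennreal_ofReal (by simp)]
  simp [ENNReal.toReal_ofReal (hp_nonneg _)]

lemma integrable_withDensity_ofReal (hp : Measurable p) (hp_nonneg : ∀ θ, 0 ≤ p θ)
    (g : Θ → ℝ) :
    Integrable g (μ.withDensity fun θ => ENNReal.ofReal (p θ)) ↔
      Integrable (fun θ => p θ * g θ) μ := by
  rw [integrable_withDensity_iff_integrable_smul' hp.ennreal_ofReal (by simp)]
  simp [ENNReal.toReal_ofReal (hp_nonneg _)]

/-- Importance weights: the second moment of `γ / p` under the density `p`. -/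
lemma importance_weight_sq (hp : Measurable p) (hp_nonneg : ∀ θ, 0 ≤ p θ)
    (hp_pos : ∀ᵐ θ ∂μ, 0 < p θ) (hγ : Measurable γ)
    (hI : Integrable (fun θ => γ θ ^ 2 / p θ) μ) :
    MemLp (fun θ => γ θ / p θ) 2 (μ.withDensity fun θ => ENNReal.ofReal (p θ)) ∧
      ∫ θ, (γ θ / p θ) ^ 2 ∂(μ.withDensity fun θ => ENNReal.ofReal (p θ)) =
        ∫ θ, γ θ ^ 2 / p θ ∂μ := by
  have hae : (fun θ => p θ * (γ θ / p θ) ^ 2) =ᵐ[μ] fun θ => γ θ ^ 2 / p θ := by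
    filter_upwards [hp_pos] with θ hθ
    field_simp
  constructor
  · have hmeas : Measurable fun θ => γ θ / p θ := hγ.div hp
    rw [memLp_two_iff_integrable_sq hmeas.aestronglyMeasurable,
      integrable_withDensity_ofReal hp hp_nonneg]
    exact hI.congr hae.symm
  · rw [integral_withDensity_ofReal hp hp_nonneg]
    exact integral_congr_ae hae

/-- Random feature approximation of `∫ γ g dμ` by importance sampling from the density `p`. -/
lemma random_feature_approximation (hp : Measurable p) (hp_nonneg : ∀ θ, 0 ≤ p θ)
    [IsProbabilityMeasure (μ.withDensity fun θ => ENNReal.ofReal (p θ))]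
    (hp_pos : ∀ᵐ θ ∂μ, 0 < p θ) (hγ : Measurable γ)
    (hI : Integrable (fun θ => γ θ ^ 2 / p θ) μ) {g : Θ → ℝ} (hg : Measurable g)
    (hg_bdd : ∀ θ, |g θ| ≤ √2) {m : ℕ} (hm : 0 < m) (c : ℝ) :
    Integrable (fun ω : Fin m → Θ => ((∑ k, γ (ω k) / p (ω k) / m * g (ω k)) - c) ^ 2)
        (Measure.pi fun _ => μ.withDensity fun θ => ENNReal.ofReal (p θ)) ∧
      ∫ ω : Fin m → Θ, ((∑ k, γ (ω k) / p (ω k) / m * g (ω k)) - c) ^ 2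
          ∂(Measure.pi fun _ => μ.withDensity fun θ => ENNReal.ofReal (p θ)) ≤
        (∫ θ, γ θ * g θ ∂μ - c) ^ 2 + 2 * (∫ θ, γ θ ^ 2 / p θ ∂μ) / m := by
  obtain ⟨hw, hw_int⟩ := importance_weight_sq hp hp_nonneg hp_pos hγ hI
  have hg2 : ∀ θ, g θ ^ 2 ≤ 2 := fun θ => by
    have := pow_le_pow_left₀ (abs_nonneg _) (hg_bdd θ) 2
    rwa [sq_abs, Real.sq_sqrt (by norm_num)] at this
  have hle : ∀ θ, (γ θ / p θ * g θ) ^ 2 ≤ 2 * (γ θ / p θ) ^ 2 := fun θ => by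
    rw [mul_pow, mul_comm]
    exact mul_le_mul_of_nonneg_right (hg2 θ) (sq_nonneg _)
  have hmeas : Measurable fun θ => γ θ / p θ * g θ := (hγ.div hp).mul hg
  have hsq : Integrable (fun θ => 2 * (γ θ / p θ) ^ 2)
      (μ.withDensity fun θ => ENNReal.ofReal (p θ)) := hw.integrable_sq.const_mul 2
  have hX : MemLp (fun θ => γ θ / p θ * g θ) 2
      (μ.withDensity fun θ => ENNReal.ofReal (p θ)) := by
    rw [memLp_two_iff_integrable_sq hmeas.aestronglyMeasurable]
    refine hsq.mono' (hmeas.pow_const 2).aestronglyMeasurable (.of_forall fun θ => ?_)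
    rw [Real.norm_of_nonneg (sq_nonneg _)]
    exact hle θ
  have hmean : ∫ θ, γ θ / p θ * g θ ∂(μ.withDensity fun θ => ENNReal.ofReal (p θ)) =
      ∫ θ, γ θ * g θ ∂μ := by
    rw [integral_withDensity_ofReal hp hp_nonneg]
    refine integral_congr_ae ?_
    filter_upwards [hp_pos] with θ hθ
    field_simp
  have hsecond : ∫ θ, (γ θ / p θ * g θ) ^ 2 ∂(μ.withDensity fun θ => ENNReal.ofReal (p θ)) ≤
      2 * ∫ θ, γ θ ^ 2 / p θ ∂μ := by
    rw [← hw_int, ← integral_const_mul]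
    exact integral_mono hX.integrable_sq hsq hle
  obtain ⟨h1, h2⟩ := integral_sq_empirical_mean_sub_le hX hm c
  rw [hmean] at h2
  simp_rw [div_mul_eq_mul_div _ (m : ℝ)]
  refine ⟨h1, h2.trans ?_⟩
  gcongr

end RandomFeatures

section TwoLevel

/-- Deterministic loss bound for the two-level VAW procedure: the meta-level competes with
every comparator `v` of the `j`-th expert. -/
lemma two_level_vaw_loss_le {N m T : ℕ} {lam Y : ℝ} (hlam : 0 < lam) (y : ℕ → ℝ)
    (hy : ∀ t ∈ Finset.Icc 1 T, |y t| ≤ Y) (Φ : Fin N → ℕ → Fin m → ℝ)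
    (hΦ : ∀ i t k, |Φ i t k| ≤ √2) (z : ℕ → Fin N → ℝ)
    (hz : ∀ t i, z t i = ∑ k, vaw lam (Φ i) y t k * Φ i t k) (j : Fin N) (v : Fin m → ℝ) :
    ∑ t ∈ Finset.Icc 1 T, ((∑ i, vaw lam z y t i * z t i) - y t) ^ 2 ≤
      ∑ t ∈ Finset.Icc 1 T, ((∑ k, v k * Φ j t k) - y t) ^ 2 + lam * ∑ k, v k ^ 2 +
        m * Y ^ 2 * Real.log (1 + 2 * T / lam) + lam +
        N * Y ^ 2 * Real.log (1 + Y ^ 2 / lam *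
          (2 * T * (T + 1) + 2 * m * T * Real.log (1 + 2 * T / lam))) := by
  have hB : (0 : ℝ) ≤ 2 * T / lam := by positivity
  have hL : 0 ≤ Real.log (1 + 2 * T / lam) := Real.log_nonneg (by linarith)
  have hu : ∀ i, ∑ t ∈ Finset.Icc 1 T, ∑ k, Φ i t k ^ 2 ≤
      Fintype.card (Fin m) * (lam * (2 * T / lam)) := fun i => by
    have hsq : ∀ t k, Φ i t k ^ 2 ≤ 2 := fun t k => by
      have := pow_le_pow_left₀ (abs_nonneg _) (hΦ i t k) 2
      rwa [sq_abs, Real.sq_sqrt (by norm_num)] at this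
    calc ∑ t ∈ Finset.Icc 1 T, ∑ k, Φ i t k ^ 2
        ≤ ∑ _t ∈ Finset.Icc 1 T, ∑ _k : Fin m, (2 : ℝ) :=
          Finset.sum_le_sum fun t _ => Finset.sum_le_sum fun k _ => hsq t k
      _ = Fintype.card (Fin m) * (lam * (2 * T / lam)) := by
          rw [mul_div_cancel₀ _ hlam.ne']
          simp
          ring
  have hexpert := vaw_regret hlam (Φ j) y T hy hB (hu j) v
  have hT : (4 * T + 2 * m * Real.log (1 + 2 * T / lam) : ℝ) ≤
      2 * T * (T + 1) + 2 * m * T * Real.log (1 + 2 * T / lam) := by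
    rcases Nat.eq_zero_or_pos T with rfl | hT
    · simp
    · have hT' : (1 : ℝ) ≤ T := by exact_mod_cast hT
      have hmL : 0 ≤ (m : ℝ) * Real.log (1 + 2 * T / lam) := by positivity
      nlinarith [mul_le_mul_of_nonneg_right hT' hmL]
  have hz2 : ∑ t ∈ Finset.Icc 1 T, ∑ i, z t i ^ 2 ≤ Fintype.card (Fin N) *
      (lam * (Y ^ 2 / lam *
        (2 * T * (T + 1) + 2 * m * T * Real.log (1 + 2 * T / lam)))) := by
    rw [Finset.sum_comm, ← mul_assoc lam, mul_div_cancel₀ _ hlam.ne', ← nsmul_eq_mul,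
      ← Finset.card_univ]
    refine Finset.sum_le_card_nsmul _ _ _ fun i _ => ?_
    simp_rw [hz]
    refine (vaw_sum_sq_prediction_le hlam (Φ i) y T hy hB (hu i)).trans ?_
    rw [Fintype.card_fin]
    exact mul_le_mul_of_nonneg_left hT (sq_nonneg Y)
  have hmeta := vaw_regret hlam z y T hy (by positivity) hz2 (Pi.single j 1)
  simp only [Pi.single_apply, ite_mul, one_mul, zero_mul, Finset.sum_ite_eq', Finset.mem_univ,
    if_true, ite_pow, one_pow, ne_eq, OfNat.ofNat_ne_zero, not_false_eq_true, zero_pow,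
    Fintype.card_fin] at hmeta
  simp_rw [hz _ j] at hmeta
  rw [Fintype.card_fin] at hexpert
  linarith

end TwoLevel

/-- **Theorem 2: loss bound for the two-level VAW² algorithm (relation (3.14)).**
Multi-kernel random feature setup: for each `j`, `(Θⱼ, μⱼ)` σ-finite, `pⱼ`
probability densities, `φⱼ` measurable with `|φⱼ| ≤ √2`; the independent family
`(θⱼₖ)`, `θⱼₖ ~ pⱼ·μⱼ`, is modelled by the product measure on `Π j, Fin m → Θ j`.
First level: for each `j`, `w_{t,j}` are the VAW iterates on `(Φ_{θⱼ}(x_t), y_t)`;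
the expert prediction vector is `z_t = (⟨w_{t,j}, Φ_{θⱼ}(x_t)⟩)ⱼ`.
Second level: `α_t` are the VAW iterates (same `λ`) on `(z_t, y_t)`.
For every `j` and every coefficient function `γⱼ` with `Iⱼ = ∫ γⱼ²/pⱼ dμⱼ < ∞`
and `fⱼ(x) = ∫ γⱼ(θ) φⱼ(x,θ) dμⱼ(θ)`:
`(1/2) E_θ[∑ₜ (⟨α_t, z_t⟩ − y_t)²] ≤ (1/2) ∑ₜ (fⱼ(x_t) − y_t)² + λ/2
  + (λ/2 + T) Iⱼ/m + (m Y²/2) ln(1 + 2T/λ)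
  + (N Y²/2) ln(1 + (Y²/λ)(2T(T+1) + 2mT ln(1 + 2T/λ)))`. -/
theorem vaw_squared_loss_bound
    (d N m T : ℕ) (hm : 0 < m) (lam Y : ℝ) (hlam : 0 < lam) (hY : 0 < Y)
    (Θ : Fin N → Type*) [∀ j, MeasurableSpace (Θ j)]
    (μ : ∀ j, Measure (Θ j)) [∀ j, SigmaFinite (μ j)]
    (p : ∀ j, Θ j → ℝ) (hp_meas : ∀ j, Measurable (p j))
    (hp_nonneg : ∀ j θ, 0 ≤ p j θ)
    (hp_prob : ∀ j, ∫⁻ θ, ENNReal.ofReal (p j θ) ∂(μ j) = 1)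
    (hp_pos : ∀ j, ∀ᵐ θ ∂(μ j), 0 < p j θ)
    (φ : ∀ j, (Fin d → ℝ) → Θ j → ℝ)
    (hφ_meas : ∀ j, Measurable (fun q : (Fin d → ℝ) × Θ j => φ j q.1 q.2))
    (hφ_bdd : ∀ j x θ, |φ j x θ| ≤ Real.sqrt 2)
    (x : ℕ → Fin d → ℝ) (y : ℕ → ℝ)
    (hy : ∀ t ∈ Finset.Icc 1 T, |y t| ≤ Y)
    -- the expert predictions `z ω t j = ⟨w_{t,j}, Φ_{θⱼ}(x_t)⟩`
    (z : (∀ j, Fin m → Θ j) → ℕ → Fin N → ℝ)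
    (hz : ∀ ω t j, z ω t j =
      ∑ k, vaw lam (fun s k' => φ j (x s) (ω j k')) y t k * φ j (x t) (ω j k))
    -- the meta-level VAW iterates `α_t` applied to `(z_t, y_t)`
    (α : (∀ j, Fin m → Θ j) → ℕ → Fin N → ℝ)
    (hα : ∀ ω t, α ω t = vaw lam (z ω) y t)
    (j : Fin N) (γj : Θ j → ℝ) (hγ_meas : Measurable γj)
    (hI : Integrable (fun θ => γj θ ^ 2 / p j θ) (μ j)) :
    (1 / 2) * ∫ ω : ∀ j, Fin m → Θ j,
        (∑ t ∈ Finset.Icc 1 T, ((∑ i, α ω t i * z ω t i) - y t) ^ 2)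
        ∂(Measure.pi fun j' =>
            Measure.pi fun _ : Fin m => (μ j').withDensity fun θ => ENNReal.ofReal (p j' θ))
      ≤ (1 / 2) * ∑ t ∈ Finset.Icc 1 T, ((∫ θ, γj θ * φ j (x t) θ ∂(μ j)) - y t) ^ 2
        + lam / 2
        + (lam / 2 + T) * (∫ θ, γj θ ^ 2 / p j θ ∂(μ j)) / m
        + m * Y ^ 2 / 2 * Real.log (1 + 2 * T / lam)
        + N * Y ^ 2 / 2 * Real.log (1 + Y ^ 2 / lam *
            (2 * T * (T + 1) + 2 * m * T * Real.log (1 + 2 * T / lam))) := by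
  have hprob : ∀ i, IsProbabilityMeasure ((μ i).withDensity fun θ => ENNReal.ofReal (p i θ)) :=
    fun i => ⟨by rw [withDensity_apply _ .univ, Measure.restrict_univ, hp_prob i]⟩
  have hm' : (m : ℝ) ≠ 0 := by positivity
  obtain ⟨hw, hw_int⟩ := importance_weight_sq (hp_meas j) (hp_nonneg j) (hp_pos j) hγ_meas hI
  have hφx : ∀ t, Measurable (φ j (x t)) := fun t => (hφ_meas j).comp measurable_prodMk_left
  have happrox := fun t => random_feature_approximation (hp_meas j) (hp_nonneg j) (hp_pos j)
    hγ_meas hI (hφx t) (hφ_bdd j (x t)) hm (y t)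
  have hnorm_int : Integrable (fun η : Fin m → Θ j => ∑ k, (γj (η k) / p j (η k) / m) ^ 2)
      (Measure.pi fun _ => (μ j).withDensity fun θ => ENNReal.ofReal (p j θ)) := by
    simp_rw [div_pow _ (m : ℝ)]
    exact integrable_finsetSum _ fun k _ => integrable_comp_eval
      (μ := fun _ : Fin m => (μ j).withDensity fun θ => ENNReal.ofReal (p j θ))
      (hw.integrable_sq.div_const _)
  have hnorm : ∫ η : Fin m → Θ j, (∑ k, (γj (η k) / p j (η k) / m) ^ 2)
      ∂(Measure.pi fun _ => (μ j).withDensity fun θ => ENNReal.ofReal (p j θ)) =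
        (∫ θ, γj θ ^ 2 / p j θ ∂(μ j)) / m := by
    simp_rw [div_pow _ (m : ℝ)]
    rw [integral_finsetSum _ fun k _ => integrable_comp_eval
      (μ := fun _ : Fin m => (μ j).withDensity fun θ => ENNReal.ofReal (p j θ))
      (hw.integrable_sq.div_const _)]
    simp_rw [integral_comp_eval
      (μ := fun _ : Fin m => (μ j).withDensity fun θ => ENNReal.ofReal (p j θ))
      (hw.integrable_sq.div_const ((m : ℝ) ^ 2)).aestronglyMeasurable]
    simp only [integral_div, hw_int, Finset.sum_const, Finset.card_univ, Fintype.card_fin,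
      nsmul_eq_mul]
    field_simp
  set C : ℝ := m * Y ^ 2 * Real.log (1 + 2 * T / lam) + lam +
    N * Y ^ 2 * Real.log (1 + Y ^ 2 / lam *
      (2 * T * (T + 1) + 2 * m * T * Real.log (1 + 2 * T / lam))) with hC
  let G : (Fin m → Θ j) → ℝ := fun η =>
    ∑ t ∈ Finset.Icc 1 T, ((∑ k, γj (η k) / p j (η k) / m * φ j (x t) (η k)) - y t) ^ 2 +
      lam * ∑ k, (γj (η k) / p j (η k) / m) ^ 2 + C
  have hsum_int := integrable_finsetSum (Finset.Icc 1 T) fun t _ => (happrox t).1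
  have hG_int : Integrable G
      (Measure.pi fun _ => (μ j).withDensity fun θ => ENNReal.ofReal (p j θ)) :=
    (hsum_int.add (hnorm_int.const_mul lam)).add (integrable_const C)
  have hpoint : ∀ ω : ∀ i, Fin m → Θ i,
      ∑ t ∈ Finset.Icc 1 T, ((∑ i, α ω t i * z ω t i) - y t) ^ 2 ≤ G (ω j) := fun ω => by
    simp_rw [hα]
    refine (two_level_vaw_loss_le hlam y hy (fun i t k => φ i (x t) (ω i k))
      (fun i t k => hφ_bdd i (x t) (ω i k)) (z ω) (fun t i => hz ω t i) j
      (fun k => γj (ω j k) / p j (ω j k) / m)).trans_eq ?_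
    simp only [G, hC]
    ring
  have hmono := integral_mono_of_nonneg
    (μ := Measure.pi fun i =>
      Measure.pi fun _ : Fin m => (μ i).withDensity fun θ => ENNReal.ofReal (p i θ))
    (.of_forall fun ω => Finset.sum_nonneg fun t _ => sq_nonneg _)
    (integrable_comp_eval hG_int) (.of_forall hpoint)
  rw [integral_comp_eval (i := j) hG_int.aestronglyMeasurable] at hmono
  have hG : ∫ η, G η ∂(Measure.pi fun _ => (μ j).withDensity fun θ => ENNReal.ofReal (p j θ)) ≤
      ∑ t ∈ Finset.Icc 1 T, ((∫ θ, γj θ * φ j (x t) θ ∂(μ j)) - y t) ^ 2 +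
        T * (2 * (∫ θ, γj θ ^ 2 / p j θ ∂(μ j)) / m) +
        lam * ((∫ θ, γj θ ^ 2 / p j θ ∂(μ j)) / m) + C := by
    simp only [G]
    rw [integral_add (by exact hsum_int.add (hnorm_int.const_mul lam)) (integrable_const C),
      integral_add hsum_int (hnorm_int.const_mul lam), integral_const_mul, hnorm,
      integral_finsetSum _ fun t _ => (happrox t).1]
    have h := Finset.sum_le_sum fun t (_ : t ∈ Finset.Icc 1 T) => (happrox t).2
    rw [Finset.sum_add_distrib] at h
    simp only [Finset.sum_const, Nat.card_Icc, Nat.add_sub_cancel, nsmul_eq_mul] at h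
    simp only [integral_const, probReal_univ, one_smul]
    linarith
  calc _ ≤ (1 / 2) * (∑ t ∈ Finset.Icc 1 T, ((∫ θ, γj θ * φ j (x t) θ ∂(μ j)) - y t) ^ 2 +
        T * (2 * (∫ θ, γj θ ^ 2 / p j θ ∂(μ j)) / m) +
        lam * ((∫ θ, γj θ ^ 2 / p j θ ∂(μ j)) / m) + C) :=
        mul_le_mul_of_nonneg_left (hmono.trans hG) (by norm_num)
    _ = _ := by
        rw [hC]
        ring
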